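/- arXiv:2409.05483 — 11 statements merged into one kernel-verified Lean document; each statement's English description precedes it below -/
import Mathlib

section
/- Let c > 0 and l > c be real numbers, and let x be a real number with (l - c)/2 < x < (l + c)/2. Then each of the three quantities (cosh x · cosh c − cosh(l − x))/(sinh x · sinh c), (cosh(l − x) · cosh c − cosh x)/(sinh(l − x) · sinh c), and (cosh x · cosh(l − x) − cosh c)/(sinh x · sinh(l − x)) lies strictly between −1 and 1. (This expresses that a hyperbolic triangle with side lengths x, l − x, c exists whenever these lengths satisfy the strict triangle inequalities.) -/
open Real

/-- The hyperbolic law of cosines yields the cosine of a genuine angle as soon as the side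
lengths satisfy the strict triangle inequalities. -/
theorem hyperbolic_cos_law_quotient_mem_Ioo {a b d : ℝ} (ha : 0 < a) (hb : 0 < b) (hd : 0 < d)
    (hab : d < a + b) (h : |a - b| < d) :
    -1 < (cosh a * cosh b - cosh d) / (sinh a * sinh b) ∧
      (cosh a * cosh b - cosh d) / (sinh a * sinh b) < 1 := by
  have hs : 0 < sinh a * sinh b := mul_pos (sinh_pos_iff.2 ha) (sinh_pos_iff.2 hb)
  have h_add : cosh d < cosh (a + b) :=
    cosh_lt_cosh.2 (by rwa [abs_of_pos hd, abs_of_pos (add_pos ha hb)])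
  have h_sub : cosh (a - b) < cosh d := cosh_lt_cosh.2 (by rwa [abs_of_pos hd])
  rw [cosh_add] at h_add
  rw [cosh_sub] at h_sub
  rw [lt_div_iff₀ hs, div_lt_iff₀ hs]
  constructor <;> linarith

/-- For side lengths `x`, `l - x`, `c` of a hyperbolic triangle satisfying the strict
triangle inequalities, each of the three law-of-cosines quotients lies strictly
between `-1` and `1`. -/
theorem stmt_0 (c l x : ℝ) (hc : 0 < c) (hl : c < l)
    (hx1 : (l - c) / 2 < x) (hx2 : x < (l + c) / 2) :
    (-1 < (cosh x * cosh c - cosh (l - x)) / (sinh x * sinh c) ∧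
      (cosh x * cosh c - cosh (l - x)) / (sinh x * sinh c) < 1) ∧
    (-1 < (cosh (l - x) * cosh c - cosh x) / (sinh (l - x) * sinh c) ∧
      (cosh (l - x) * cosh c - cosh x) / (sinh (l - x) * sinh c) < 1) ∧
    (-1 < (cosh x * cosh (l - x) - cosh c) / (sinh x * sinh (l - x)) ∧
      (cosh x * cosh (l - x) - cosh c) / (sinh x * sinh (l - x)) < 1) := by
  refine ⟨?_, ?_, ?_⟩ <;> apply hyperbolic_cos_law_quotient_mem_Ioo <;>
    first
    | linarith
    | exact abs_lt.2 ⟨by linarith, by linarith⟩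
end

section
/- Fix real numbers c > 0 and l > c. For x with (l − c)/2 < x < (l + c)/2 define F(x) = arccos((cosh x · cosh c − cosh(l − x))/(sinh x · sinh c)) + arccos((cosh(l − x) · cosh c − cosh x)/(sinh(l − x) · sinh c)) + arccos((cosh x · cosh(l − x) − cosh c)/(sinh x · sinh(l − x))). Then F attains a strict global minimum at x = l/2; that is, F(l/2) < F(x) for every x in ((l − c)/2, (l + c)/2) with x ≠ l/2. (Equivalently: among hyperbolic triangles with one side of fixed length c and the sum of the other two sides equal to l, the area, which is π minus the angle sum F(x), is maximized only by the isosceles triangle.) -/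
open Real

/-- The cosine of an angle of a hyperbolic triangle, by the law of cosines, where the sides
adjacent to the angle are `u + v` and `u + w` and the opposite side is `v + w`. -/
noncomputable def hypCosAngle (u v w : ℝ) : ℝ :=
  (cosh (u + w) * cosh (u + v) - cosh (v + w)) / (sinh (u + w) * sinh (u + v))

lemma one_add_hypCosAngle {u v w : ℝ} (hu : 0 < u) (hv : 0 < v) (hw : 0 < w) :
    (1 + hypCosAngle u v w) / 2 =
      sinh (u + v + w) * sinh u / (sinh (u + w) * sinh (u + v)) := by
  have h1 : 0 < sinh (u + w) := sinh_pos_iff.2 (by positivity)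
  have h2 : 0 < sinh (u + v) := sinh_pos_iff.2 (by positivity)
  have e1 := cosh_add (u + w) (u + v)
  have e2 := cosh_add (u + v + w) u
  have e3 := cosh_sub (u + v + w) u
  rw [show u + w + (u + v) = u + v + w + u by ring] at e1
  rw [show u + v + w - u = v + w by ring] at e3
  unfold hypCosAngle
  field_simp
  linarith

lemma one_sub_hypCosAngle {u v w : ℝ} (hu : 0 < u) (hv : 0 < v) (hw : 0 < w) :
    (1 - hypCosAngle u v w) / 2 =
      sinh v * sinh w / (sinh (u + w) * sinh (u + v)) := by
  have h1 : 0 < sinh (u + w) := sinh_pos_iff.2 (by positivity)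
  have h2 : 0 < sinh (u + v) := sinh_pos_iff.2 (by positivity)
  have e1 := cosh_sub (u + w) (u + v)
  have e2 := cosh_add v w
  have e3 := cosh_sub w v
  rw [show u + w - (u + v) = w - v by ring] at e1
  unfold hypCosAngle
  field_simp
  linarith

lemma cos_half_arccos_hypCosAngle {u v w : ℝ} (hu : 0 < u) (hv : 0 < v) (hw : 0 < w) :
    cos (arccos (hypCosAngle u v w) / 2) =
      √(sinh (u + v + w)) * √(sinh u) / (√(sinh (u + w)) * √(sinh (u + v))) := by
  have hs := sinh_pos_iff.2 (show 0 < u + v + w by positivity)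
  have hb := sinh_pos_iff.2 (show 0 < u + w by positivity)
  have hu' := sinh_pos_iff.2 hu
  have hv' := sinh_pos_iff.2 hv
  have hw' := sinh_pos_iff.2 hw
  have hc := sinh_pos_iff.2 (show 0 < u + v by positivity)
  have h1 := one_add_hypCosAngle hu hv hw
  have h2 := one_sub_hypCosAngle hu hv hw
  have h3 : 0 < sinh (u + v + w) * sinh u / (sinh (u + w) * sinh (u + v)) := by positivity
  have h4 : 0 < sinh v * sinh w / (sinh (u + w) * sinh (u + v)) := by positivity
  rw [cos_half (by linarith [arccos_nonneg (hypCosAngle u v w), pi_pos]) (arccos_le_pi _),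
    cos_arccos (by linarith) (by linarith), h1, sqrt_div (by positivity), sqrt_mul hs.le,
    sqrt_mul hb.le]

lemma sin_half_arccos_hypCosAngle {u v w : ℝ} (hu : 0 < u) (hv : 0 < v) (hw : 0 < w) :
    sin (arccos (hypCosAngle u v w) / 2) =
      √(sinh v) * √(sinh w) / (√(sinh (u + w)) * √(sinh (u + v))) := by
  have hs := sinh_pos_iff.2 (show 0 < u + v + w by positivity)
  have hb := sinh_pos_iff.2 (show 0 < u + w by positivity)
  have hu' := sinh_pos_iff.2 hu
  have hv' := sinh_pos_iff.2 hv
  have hw' := sinh_pos_iff.2 hw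
  have hc := sinh_pos_iff.2 (show 0 < u + v by positivity)
  have h1 := one_add_hypCosAngle hu hv hw
  have h2 := one_sub_hypCosAngle hu hv hw
  have h3 : 0 < sinh (u + v + w) * sinh u / (sinh (u + w) * sinh (u + v)) := by positivity
  have h4 : 0 < sinh v * sinh w / (sinh (u + w) * sinh (u + v)) := by positivity
  rw [sin_half_eq_sqrt (arccos_nonneg _) (by linarith [arccos_le_pi (hypCosAngle u v w), pi_pos]),
    cos_arccos (by linarith) (by linarith), h2, sqrt_div (by positivity), sqrt_mul hv'.le,
    sqrt_mul hb.le]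

/-- The angle sum of the hyperbolic triangle with sides `v + w`, `u + w` and `u + v`. -/
noncomputable def hypAngleSum (u v w : ℝ) : ℝ :=
  arccos (hypCosAngle u v w) + arccos (hypCosAngle v w u) + arccos (hypCosAngle w u v)

lemma sin_half_hypAngleSum {u v w : ℝ} (hu : 0 < u) (hv : 0 < v) (hw : 0 < w) :
    sin (hypAngleSum u v w / 2) =
      (sinh (u + v + w) * (sinh v * sinh w + sinh u * sinh w + sinh u * sinh v)
        - sinh u * sinh v * sinh w) / (sinh (v + w) * sinh (u + w) * sinh (u + v)) := by
  have hA := sqrt_pos.2 (sinh_pos_iff.2 (show 0 < v + w by positivity))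
  have hB := sqrt_pos.2 (sinh_pos_iff.2 (show 0 < u + w by positivity))
  have hC := sqrt_pos.2 (sinh_pos_iff.2 (show 0 < u + v by positivity))
  have eA := sq_sqrt (sinh_pos_iff.2 (show 0 < v + w by positivity)).le
  have eB := sq_sqrt (sinh_pos_iff.2 (show 0 < u + w by positivity)).le
  have eC := sq_sqrt (sinh_pos_iff.2 (show 0 < u + v by positivity)).le
  have eS := sq_sqrt (sinh_pos_iff.2 (show 0 < u + v + w by positivity)).le
  have eu := sq_sqrt (sinh_pos_iff.2 hu).le
  have ev := sq_sqrt (sinh_pos_iff.2 hv).le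
  have ew := sq_sqrt (sinh_pos_iff.2 hw).le
  rw [hypAngleSum, add_div, add_div, sin_add, sin_add, cos_add,
    cos_half_arccos_hypCosAngle hu hv hw, cos_half_arccos_hypCosAngle hv hw hu,
    cos_half_arccos_hypCosAngle hw hu hv, sin_half_arccos_hypCosAngle hu hv hw,
    sin_half_arccos_hypCosAngle hv hw hu, sin_half_arccos_hypCosAngle hw hu hv,
    show v + w + u = u + v + w by ring, show w + u + v = u + v + w by ring,
    add_comm v u, add_comm w v, add_comm w u]
  generalize √(sinh (v + w)) = A at *
  generalize √(sinh (u + w)) = B at *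
  generalize √(sinh (u + v)) = C at *
  generalize √(sinh (u + v + w)) = S at *
  generalize √(sinh u) = p at *
  generalize √(sinh v) = q at *
  generalize √(sinh w) = r at *
  rw [← eA, ← eB, ← eC, ← eS, ← eu, ← ev, ← ew]
  field_simp
  ring

lemma cos_half_hypAngleSum {u v w : ℝ} (hu : 0 < u) (hv : 0 < v) (hw : 0 < w) :
    cos (hypAngleSum u v w / 2) =
      √(sinh (u + v + w)) * √(sinh u) * √(sinh v) * √(sinh w) *
        (sinh (u + v + w) - sinh u - sinh v - sinh w) /
          (sinh (v + w) * sinh (u + w) * sinh (u + v)) := by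
  have hA := sqrt_pos.2 (sinh_pos_iff.2 (show 0 < v + w by positivity))
  have hB := sqrt_pos.2 (sinh_pos_iff.2 (show 0 < u + w by positivity))
  have hC := sqrt_pos.2 (sinh_pos_iff.2 (show 0 < u + v by positivity))
  have eA := sq_sqrt (sinh_pos_iff.2 (show 0 < v + w by positivity)).le
  have eB := sq_sqrt (sinh_pos_iff.2 (show 0 < u + w by positivity)).le
  have eC := sq_sqrt (sinh_pos_iff.2 (show 0 < u + v by positivity)).le
  have eS := sq_sqrt (sinh_pos_iff.2 (show 0 < u + v + w by positivity)).le
  have eu := sq_sqrt (sinh_pos_iff.2 hu).le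
  have ev := sq_sqrt (sinh_pos_iff.2 hv).le
  have ew := sq_sqrt (sinh_pos_iff.2 hw).le
  rw [hypAngleSum, add_div, add_div, cos_add, sin_add, cos_add,
    cos_half_arccos_hypCosAngle hu hv hw, cos_half_arccos_hypCosAngle hv hw hu,
    cos_half_arccos_hypCosAngle hw hu hv, sin_half_arccos_hypCosAngle hu hv hw,
    sin_half_arccos_hypCosAngle hv hw hu, sin_half_arccos_hypCosAngle hw hu hv,
    show v + w + u = u + v + w by ring, show w + u + v = u + v + w by ring,
    add_comm v u, add_comm w v, add_comm w u]
  generalize √(sinh (v + w)) = A at *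
  generalize √(sinh (u + w)) = B at *
  generalize √(sinh (u + v)) = C at *
  generalize √(sinh (u + v + w)) = S at *
  generalize √(sinh u) = p at *
  generalize √(sinh v) = q at *
  generalize √(sinh w) = r at *
  rw [← eA, ← eB, ← eC, ← eS, ← eu, ← ev, ← ew]
  field_simp
  ring

lemma sinh_add_lt_sinh_add {x y : ℝ} (hx : 0 < x) (hy : 0 < y) :
    sinh x + sinh y < sinh (x + y) := by
  rw [sinh_add]
  nlinarith [one_lt_cosh.2 hx.ne', one_lt_cosh.2 hy.ne', sinh_pos_iff.2 hx, sinh_pos_iff.2 hy]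

lemma hypAngleSum_nonneg (u v w : ℝ) : 0 ≤ hypAngleSum u v w :=
  add_nonneg (add_nonneg (arccos_nonneg _) (arccos_nonneg _)) (arccos_nonneg _)

lemma hypAngleSum_lt_pi {u v w : ℝ} (hu : 0 < u) (hv : 0 < v) (hw : 0 < w) :
    hypAngleSum u v w < π := by
  have hcos : 0 < cos (hypAngleSum u v w / 2) := by
    rw [cos_half_hypAngleSum hu hv hw]
    have h1 := sinh_add_lt_sinh_add hu hv
    have h2 := sinh_add_lt_sinh_add (add_pos hu hv) hw
    have h3 : 0 < sinh (u + v + w) - sinh u - sinh v - sinh w := by linarith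
    have := sinh_pos_iff.2 (show 0 < u + v + w by positivity)
    have := sinh_pos_iff.2 (show 0 < v + w by positivity)
    have := sinh_pos_iff.2 (show 0 < u + w by positivity)
    have := sinh_pos_iff.2 (show 0 < u + v by positivity)
    have := sinh_pos_iff.2 hu
    have := sinh_pos_iff.2 hv
    have := sinh_pos_iff.2 hw
    positivity
  by_contra! h
  have hle : hypAngleSum u v w ≤ 3 * π := by
    unfold hypAngleSum
    linarith [arccos_le_pi (hypCosAngle u v w), arccos_le_pi (hypCosAngle v w u),
      arccos_le_pi (hypCosAngle w u v)]
  exact hcos.not_ge (cos_nonpos_of_pi_div_two_le_of_le (by linarith) (by linarith))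

/-- The sides of the triangle are `m + d`, `m - d` and `2 * h`. -/
lemma sin_half_hypAngleSum_eq {m h d : ℝ} (hm : h < m) (h1 : d < h) (h2 : -h < d) :
    sin (hypAngleSum (h - d) (h + d) (m - h) / 2) =
      (cosh h ^ 2 + cosh m * cosh d) / (cosh h * (cosh m + cosh d)) := by
  rw [sin_half_hypAngleSum (by linarith) (by linarith) (by linarith),
    show h - d + (h + d) + (m - h) = m + h by ring, show h + d + (m - h) = m + d by ring,
    show h - d + (m - h) = m - d by ring, show h - d + (h + d) = 2 * h by ring]
  have hA := sinh_pos_iff.2 (show 0 < m + d by linarith)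
  have hB := sinh_pos_iff.2 (show 0 < m - d by linarith)
  have hh := sinh_pos_iff.2 (show 0 < h by linarith)
  have hC := sinh_pos_iff.2 (show 0 < 2 * h by linarith)
  have km := cosh_pos m
  have kh := cosh_pos h
  have kd := cosh_pos d
  rw [div_eq_div_iff (by positivity) (by positivity), sinh_two_mul]
  simp only [sinh_add, sinh_sub]
  have em := sinh_sq m
  have eh := sinh_sq h
  have ed := sinh_sq d
  generalize sinh m = a at *
  generalize sinh h = b at *
  generalize sinh d = e at *
  have s1 : (a * cosh h + cosh m * b) * (a * cosh h - cosh m * b) =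
      cosh m ^ 2 - cosh h ^ 2 := by linear_combination cosh h ^ 2 * em - cosh m ^ 2 * eh
  have s2 : (b * cosh d - cosh h * e) * (b * cosh d + cosh h * e) =
      cosh h ^ 2 - cosh d ^ 2 := by linear_combination cosh d ^ 2 * eh - cosh h ^ 2 * ed
  have s3 : (a * cosh d + cosh m * e) * (a * cosh d - cosh m * e) =
      cosh m ^ 2 - cosh d ^ 2 := by linear_combination cosh d ^ 2 * em - cosh m ^ 2 * ed
  linear_combination
    (2 * b * cosh d * (cosh h * (cosh m + cosh d))) * s1 +
    (2 * b * cosh m * (cosh h * (cosh m + cosh d))) * s2 -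
    (cosh h ^ 2 + cosh m * cosh d) * (2 * b * cosh h) * s3

lemma hypAngleSum_isosceles_lt {m h d : ℝ} (hm : h < m) (h1 : d < h) (h2 : -h < d)
    (hd : d ≠ 0) :
    hypAngleSum (h - 0) (h + 0) (m - h) < hypAngleSum (h - d) (h + d) (m - h) := by
  have hh : 0 < h := by linarith
  have hlt : sin (hypAngleSum (h - 0) (h + 0) (m - h) / 2) <
      sin (hypAngleSum (h - d) (h + d) (m - h) / 2) := by
    rw [sin_half_hypAngleSum_eq hm hh (by linarith), sin_half_hypAngleSum_eq hm h1 h2, cosh_zero]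
    have km := cosh_pos m
    have kh := cosh_pos h
    have kd := one_lt_cosh.2 hd
    have hmh : cosh h < cosh m := cosh_lt_cosh.2 (by
      rwa [abs_of_pos hh, abs_of_pos (hh.trans hm)])
    rw [div_lt_div_iff₀ (by positivity) (by positivity)]
    have : 0 < cosh h * (cosh d - 1) * (cosh m ^ 2 - cosh h ^ 2) :=
      mul_pos (mul_pos kh (by linarith)) (by nlinarith)
    linarith
  have hpi : hypAngleSum (h - 0) (h + 0) (m - h) < π :=
    hypAngleSum_lt_pi (by linarith) (by linarith) (by linarith)
  by_contra! hle
  exact hlt.not_ge (sin_le_sin_of_le_of_le_pi_div_two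
    (by linarith [pi_pos, hypAngleSum_nonneg (h - d) (h + d) (m - h)])
    (by linarith) (by linarith))

/-- The angle-sum function of a hyperbolic triangle with one side of length `c` and the
other two sides summing to `l` attains a strict global minimum at the isosceles
configuration `x = l / 2`. -/
theorem stmt_1 (c l : ℝ) (hc : 0 < c) (hl : c < l)
    (F : ℝ → ℝ)
    (hF : ∀ x : ℝ, F x =
      arccos ((cosh x * cosh c - cosh (l - x)) / (sinh x * sinh c)) +
      arccos ((cosh (l - x) * cosh c - cosh x) / (sinh (l - x) * sinh c)) +
      arccos ((cosh x * cosh (l - x) - cosh c) / (sinh x * sinh (l - x)))) :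
    ∀ x ∈ Set.Ioo ((l - c) / 2) ((l + c) / 2), x ≠ l / 2 → F (l / 2) < F x := by
  have key (d : ℝ) :
      F (l / 2 + d) = hypAngleSum (c / 2 - d) (c / 2 + d) (l / 2 - c / 2) := by
    rw [hF, hypAngleSum, hypCosAngle, hypCosAngle, hypCosAngle,
      show l - (l / 2 + d) = l / 2 - d by ring,
      show c / 2 - d + (l / 2 - c / 2) = l / 2 - d by ring,
      show c / 2 + d + (l / 2 - c / 2) = l / 2 + d by ring,
      show c / 2 - d + (c / 2 + d) = c by ring,
      show c / 2 + d + (c / 2 - d) = c by ring,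
      show l / 2 - c / 2 + (c / 2 - d) = l / 2 - d by ring,
      show l / 2 - c / 2 + (c / 2 + d) = l / 2 + d by ring,
      mul_comm (cosh c), mul_comm (sinh c)]
    ring
  rintro x ⟨hx1, hx2⟩ hx
  have h := hypAngleSum_isosceles_lt (m := l / 2) (h := c / 2) (d := x - l / 2)
    (by linarith) (by linarith) (by linarith) (sub_ne_zero.2 hx)
  rwa [← key, ← key, add_zero, add_sub_cancel] at h
end

section
/- Fix real numbers c > 0 and l > c, and let F be the angle-sum function F(x) = arccos((cosh x · cosh c − cosh(l − x))/(sinh x · sinh c)) + arccos((cosh(l − x) · cosh c − cosh x)/(sinh(l − x) · sinh c)) + arccos((cosh x · cosh(l − x) − cosh c)/(sinh x · sinh(l − x))) on the interval ((l − c)/2 , (l + c)/2). Then F is differentiable on this interval, and its derivative satisfies F′(x) < 0 for (l − c)/2 < x < l/2, F′(l/2) = 0, and F′(x) > 0 for l/2 < x < (l + c)/2. -/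
open Real

/-- Derivative of `arccos (N / M)` where `0 < M` and `N ^ 2 < M ^ 2`, with `D = M ^ 2 - N ^ 2`. -/
theorem HasDerivAt.arccos_div {N M : ℝ → ℝ} {N' M' x D : ℝ} (hN : HasDerivAt N N' x)
    (hM : HasDerivAt M M' x) (hMpos : 0 < M x) (hD : M x ^ 2 - N x ^ 2 = D) (hDpos : 0 < D) :
    HasDerivAt (fun y => arccos (N y / M y)) (-(N' * M x - N x * M') / (M x * √D)) x := by
  have hu : 1 - (N x / M x) ^ 2 = D / M x ^ 2 := by
    rw [← hD]
    field_simp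
  have hupos : 0 < 1 - (N x / M x) ^ 2 := by
    rw [hu]
    positivity
  have h₁ : N x / M x ≠ -1 := fun h => by
    rw [h] at hupos
    norm_num at hupos
  have h₂ : N x / M x ≠ 1 := fun h => by
    rw [h] at hupos
    norm_num at hupos
  have h := (hasDerivAt_arccos h₁ h₂).comp x (hN.div hM hMpos.ne')
  have hs : 0 < √D := sqrt_pos.2 hDpos
  refine h.congr_deriv ?_
  rw [hu, sqrt_div hDpos.le, sqrt_sq hMpos.le]
  field_simp

/-- The Gram-type determinant of a hyperbolic triangle is positive. -/
theorem hyperbolic_triangle_gram_pos {a b c : ℝ} (hab : a < b + c) (hbc : b < c + a)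
    (hca : c < a + b) :
    0 < 1 + 2 * cosh a * cosh b * cosh c - cosh a ^ 2 - cosh b ^ 2 - cosh c ^ 2 := by
  have h₁ : cosh b < cosh (a + c) := by
    rw [cosh_lt_cosh, abs_of_pos (by linarith : 0 < a + c), abs_lt]
    constructor <;> linarith
  have h₂ : cosh (a - c) < cosh b := by
    rw [cosh_lt_cosh, abs_of_pos (by linarith : 0 < b), abs_lt]
    constructor <;> linarith
  have h := mul_pos (sub_pos.2 h₁) (sub_pos.2 h₂)
  rw [cosh_add, cosh_sub] at h
  have ha := cosh_sq a
  have hc := cosh_sq c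
  have e : sinh a ^ 2 * sinh c ^ 2 = (cosh a ^ 2 - 1) * (cosh c ^ 2 - 1) := by
    rw [ha, hc]
    ring
  linarith [h, e]

/-- The derivative of the angle sum of the hyperbolic triangle with sides `x`, `l - x`, `c`. -/
theorem hasDerivAt_hyperbolic_angle_sum {c l x : ℝ} (hc : 0 < c) (hl : c < l)
    (h₁ : (l - c) / 2 < x) (h₂ : x < (l + c) / 2) :
    HasDerivAt (fun x =>
      arccos ((cosh x * cosh c - cosh (l - x)) / (sinh x * sinh c)) +
      arccos ((cosh (l - x) * cosh c - cosh x) / (sinh (l - x) * sinh c)) +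
      arccos ((cosh x * cosh (l - x) - cosh c) / (sinh x * sinh (l - x))))
      ((cosh l - cosh c) / (sinh x * sinh (l - x) *
        √(1 + 2 * cosh x * cosh (l - x) * cosh c - cosh x ^ 2 - cosh (l - x) ^ 2 - cosh c ^ 2)) *
        (2 * (cosh (l / 2) - cosh (x - l / 2))) * sinh (x - l / 2)) x := by
  have hD := hyperbolic_triangle_gram_pos (a := x) (b := l - x) (c := c)
    (by linarith) (by linarith) (by linarith)
  have ha : 0 < sinh x := sinh_pos_iff.2 (by linarith)
  have hb : 0 < sinh (l - x) := sinh_pos_iff.2 (by linarith)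
  have hs : 0 < sinh c := sinh_pos_iff.2 hc
  have dA := hasDerivAt_cosh x
  have dSA := hasDerivAt_sinh x
  have dl : HasDerivAt (fun y => l - y) (-1) x := (hasDerivAt_id x).const_sub l
  have dB := dl.cosh
  have dSB := dl.sinh
  have k₁ := ((dA.mul_const (cosh c)).sub dB).arccos_div (dSA.mul_const (sinh c))
    (mul_pos ha hs) (by simp only [Pi.sub_apply, mul_pow, sinh_sq]; ring) hD
  have k₂ := ((dB.mul_const (cosh c)).sub dA).arccos_div (dSB.mul_const (sinh c))
    (mul_pos hb hs) (by simp only [Pi.sub_apply, mul_pow, sinh_sq]; ring) hD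
  have k₃ := ((dA.mul dB).sub_const (cosh c)).arccos_div (dSA.mul dSB)
    (mul_pos ha hb) (by simp only [Pi.mul_apply, mul_pow, sinh_sq]; ring) hD
  refine ((k₁.add k₂).add k₃).congr_deriv ?_
  have hR := sqrt_pos.2 hD
  have hL : cosh l = cosh x * cosh (l - x) + sinh x * sinh (l - x) := by
    rw [← cosh_add, add_sub_cancel]
  have hbr : 2 * (cosh (l / 2) - cosh (x - l / 2)) * sinh (x - l / 2) =
      sinh x - sinh (l - x) - (sinh x * cosh (l - x) - cosh x * sinh (l - x)) := by
    have e₁ : sinh x = sinh (l / 2 + (x - l / 2)) := by ring_nf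
    have e₂ : sinh (l - x) = sinh (l / 2 - (x - l / 2)) := by ring_nf
    have e₃ : sinh x * cosh (l - x) - cosh x * sinh (l - x) = sinh (2 * (x - l / 2)) := by
      rw [← sinh_sub]
      ring_nf
    rw [e₃, e₁, e₂, sinh_add (l / 2), sinh_sub (l / 2), sinh_two_mul]
    ring
  rw [mul_assoc (_ / _), hbr, hL]
  simp only [Pi.mul_apply, Pi.sub_apply]
  generalize √_ = R at *
  have qa := cosh_sq x
  have qb := cosh_sq (l - x)
  generalize cosh x = A at *
  generalize cosh (l - x) = B at *
  generalize sinh x = a at *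
  generalize sinh (l - x) = b at *
  field_simp
  linear_combination b * cosh c * qa - a * cosh c * qb

/-- The angle-sum function `F` is differentiable on `((l-c)/2, (l+c)/2)`, with
`F' < 0` on `((l-c)/2, l/2)`, `F'(l/2) = 0`, and `F' > 0` on `(l/2, (l+c)/2)`. -/
theorem stmt_2 (c l : ℝ) (hc : 0 < c) (hl : c < l)
    (F : ℝ → ℝ)
    (hF : ∀ x : ℝ, F x =
      arccos ((cosh x * cosh c - cosh (l - x)) / (sinh x * sinh c)) +
      arccos ((cosh (l - x) * cosh c - cosh x) / (sinh (l - x) * sinh c)) +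
      arccos ((cosh x * cosh (l - x) - cosh c) / (sinh x * sinh (l - x)))) :
    DifferentiableOn ℝ F (Set.Ioo ((l - c) / 2) ((l + c) / 2)) ∧
    (∀ x : ℝ, (l - c) / 2 < x → x < l / 2 → deriv F x < 0) ∧
    deriv F (l / 2) = 0 ∧
    (∀ x : ℝ, l / 2 < x → x < (l + c) / 2 → 0 < deriv F x) := by
  have hF' : F = _ := funext hF
  have hder {x : ℝ} (h₁ : (l - c) / 2 < x) (h₂ : x < (l + c) / 2) :=
    hF' ▸ hasDerivAt_hyperbolic_angle_sum hc hl h₁ h₂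
  have hcoef {x : ℝ} (h₁ : (l - c) / 2 < x) (h₂ : x < (l + c) / 2) :
      0 < (cosh l - cosh c) / (sinh x * sinh (l - x) *
        √(1 + 2 * cosh x * cosh (l - x) * cosh c - cosh x ^ 2 - cosh (l - x) ^ 2 - cosh c ^ 2)) *
        (2 * (cosh (l / 2) - cosh (x - l / 2))) := by
    have hD := sqrt_pos.2 (hyperbolic_triangle_gram_pos (a := x) (b := l - x) (c := c)
      (by linarith) (by linarith) (by linarith))
    have ha : 0 < sinh x := sinh_pos_iff.2 (by linarith)
    have hb : 0 < sinh (l - x) := sinh_pos_iff.2 (by linarith)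
    have hlc : 0 < cosh l - cosh c := by
      rw [sub_pos, cosh_lt_cosh, abs_of_pos hc, abs_of_pos (hc.trans hl)]
      exact hl
    have hm : 0 < cosh (l / 2) - cosh (x - l / 2) := by
      rw [sub_pos, cosh_lt_cosh, abs_of_pos (by linarith : 0 < l / 2), abs_lt]
      constructor <;> linarith
    positivity
  refine ⟨fun x hx => (hder hx.1 hx.2).differentiableAt.differentiableWithinAt,
    fun x h₁ h₂ => ?_, ?_, fun x h₁ h₂ => ?_⟩
  · have h₃ : x < (l + c) / 2 := by linarith
    rw [(hder h₁ h₃).deriv]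
    exact mul_neg_of_pos_of_neg (hcoef h₁ h₃) (sinh_neg_iff.2 (by linarith))
  · rw [(hder (by linarith) (by linarith)).deriv, sub_self, sinh_zero, mul_zero]
  · have h₃ : (l - c) / 2 < x := by linarith
    rw [(hder h₃ h₂).deriv]
    exact mul_pos (hcoef h₃ h₂) (sinh_pos_iff.2 (by linarith))
end

section
/- Fix a real number c > 0. The function G(l) = 2 · arccos(coth(l/2) · tanh(c/2)) + arccos(coth(l/2)² − (1/sinh(l/2)²) · cosh c) is strictly decreasing on the interval (c, ∞). (Equivalently: the angle sum of the isosceles hyperbolic triangle with base c and equal sides l/2 is strictly decreasing in l, so its area π − G(l) is strictly increasing in l.) -/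
open Real

/-- Twice the sum of the acute angles of a hyperbolic right triangle with hypotenuse `a` and one
leg `h`, as a single inverse cosine. -/
lemma two_mul_arccos_add_arccos {a h : ℝ} (hh : 0 < h) (ha : h < a) :
    2 * arccos (cosh a / sinh a * tanh h) +
        arccos ((cosh a / sinh a) ^ 2 - (1 / sinh a ^ 2) * cosh (2 * h)) =
      2 * arccos (sinh h / cosh h * (√(cosh a ^ 2 - cosh h ^ 2) / (cosh a + 1))) := by
  have hS : 0 < sinh h := sinh_pos_iff.2 hh
  have hSy : sinh h < sinh a := sinh_lt_sinh.2 ha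
  have hC : 0 < cosh h := cosh_pos h
  have hx : 0 < cosh a := cosh_pos a
  have hCS := cosh_sq h
  have hxy := cosh_sq a
  have h2 : cosh (2 * h) = 2 * sinh h ^ 2 + 1 := by rw [cosh_two_mul]; linarith
  rw [tanh_eq_sinh_div_cosh, h2]
  generalize sinh h = S at *
  generalize cosh h = C at *
  generalize sinh a = y at *
  generalize cosh a = x at *
  have hy : 0 < y := hS.trans hSy
  have hw : 0 ≤ x ^ 2 - C ^ 2 := by nlinarith
  have hw2 := sq_sqrt hw
  have hw0 := sqrt_nonneg (x ^ 2 - C ^ 2)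
  generalize √(x ^ 2 - C ^ 2) = w at *
  have hs0 : 0 ≤ S / y := by positivity
  have hs1 : S / y ≤ 1 := (div_le_one hy).2 hSy.le
  have hP0 : 0 ≤ x / y * (S / C) := by positivity
  have hP2 : 1 - (x / y * (S / C)) ^ 2 = (w / (y * C)) ^ 2 := by
    field_simp
    rw [hw2]
    linear_combination x ^ 2 * hCS - C ^ 2 * hxy
  have hs2 : 1 - (S / y) ^ 2 = (w / y) ^ 2 := by
    field_simp
    rw [hw2]
    linear_combination hCS - hxy
  have hP1 : x / y * (S / C) ≤ 1 := by nlinarith [sq_nonneg (w / (y * C))]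
  have hβ : arccos ((x / y) ^ 2 - 1 / y ^ 2 * (2 * S ^ 2 + 1)) = 2 * arcsin (S / y) := by
    have hcos : (x / y) ^ 2 - 1 / y ^ 2 * (2 * S ^ 2 + 1) = cos (2 * arcsin (S / y)) := by
      rw [cos_two_mul, cos_sq', sin_arcsin (by linarith) hs1]
      field_simp
      linear_combination hxy
    rw [hcos, arccos_cos (by linarith [arcsin_nonneg.2 hs0])
      (by linarith [arcsin_le_pi_div_two (S / y)])]
  have hsum : arccos (S / C * (w / (x + 1))) = arccos (x / y * (S / C)) + arcsin (S / y) := by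
    have hcos : S / C * (w / (x + 1)) = cos (arccos (x / y * (S / C)) + arcsin (S / y)) := by
      rw [cos_add, cos_arccos (by linarith) hP1, sin_arccos, cos_arcsin,
        sin_arcsin (by linarith) hs1, hP2, hs2, sqrt_sq (by positivity), sqrt_sq (by positivity)]
      field_simp
      linear_combination -w * hxy
    rw [hcos, arccos_cos (add_nonneg (arccos_nonneg _) (arcsin_nonneg.2 hs0))
      (by linarith [arcsin_le_pi_div_two (S / y), arccos_le_pi_div_two.2 hP0])]
  rw [hβ, hsum]
  ring

lemma sqrt_sq_sub_sq_div_add_one_lt {C x x' : ℝ} (hC : 1 ≤ C) (hx : C < x) (hxx' : x < x') :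
    √(x ^ 2 - C ^ 2) / (x + 1) < √(x' ^ 2 - C ^ 2) / (x' + 1) := by
  have h1 : 0 < x + 1 := by linarith
  have h2 : 0 < x' + 1 := by linarith
  have hw : 0 ≤ x ^ 2 - C ^ 2 := by nlinarith
  have hw' : 0 ≤ x' ^ 2 - C ^ 2 := by nlinarith
  refine lt_of_pow_lt_pow_left₀ 2 (by positivity) ?_
  rw [div_pow, div_pow, sq_sqrt hw, sq_sqrt hw', div_lt_div_iff₀ (by positivity) (by positivity)]
  have key : (x' ^ 2 - C ^ 2) * (x + 1) ^ 2 - (x ^ 2 - C ^ 2) * (x' + 1) ^ 2 =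
      (x' - x) * (2 * (x + 1) * (x' + 1) + (C ^ 2 - 1) * (x + x' + 2)) := by ring
  have hC2 : 0 ≤ C ^ 2 - 1 := by nlinarith
  have hd : 0 < x' - x := by linarith
  have hs : 0 < x + x' + 2 := by linarith
  have : 0 < (x' - x) * (2 * (x + 1) * (x' + 1) + (C ^ 2 - 1) * (x + x' + 2)) := by positivity
  linarith

/-- The angle sum of the isosceles hyperbolic triangle with base `c` and equal sides `l/2`
is strictly decreasing as a function of `l` on `(c, ∞)`. -/
theorem stmt_4 (c : ℝ) (hc : 0 < c) :
    StrictAntiOn (fun l : ℝ =>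
      2 * arccos ((cosh (l / 2) / sinh (l / 2)) * tanh (c / 2)) +
        arccos ((cosh (l / 2) / sinh (l / 2)) ^ 2 - (1 / sinh (l / 2) ^ 2) * cosh c))
      (Set.Ioi c) := by
  have hh : 0 < c / 2 := by linarith
  have hS : 0 < sinh (c / 2) := sinh_pos_iff.2 hh
  have hC : 0 < cosh (c / 2) := cosh_pos _
  have cosh_lt {s t : ℝ} (hs : c ≤ s) (hst : s < t) : cosh (s / 2) < cosh (t / 2) :=
    cosh_strictMonoOn (Set.mem_Ici.2 (by linarith)) (Set.mem_Ici.2 (by linarith)) (by linarith)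
  have angle_sum {l : ℝ} (hl : c < l) :=
    two_mul_arccos_add_arccos hh (show c / 2 < l / 2 by linarith)
  rw [mul_div_cancel₀ c two_ne_zero] at angle_sum
  intro l hl l' hl' hll'
  simp only [angle_sum hl, angle_sum hl']
  have hlt := mul_lt_mul_of_pos_left (sqrt_sq_sub_sq_div_add_one_lt (one_le_cosh (c / 2))
    (cosh_lt le_rfl hl) (cosh_lt (le_of_lt hl) hll')) (div_pos hS hC)
  have hratio : sinh (c / 2) / cosh (c / 2) ≤ 1 := (div_le_one hC).2 (sinh_lt_cosh _).le
  have hpos : 0 < cosh (l' / 2) := cosh_pos _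
  have hroot : √(cosh (l' / 2) ^ 2 - cosh (c / 2) ^ 2) / (cosh (l' / 2) + 1) ≤ 1 := by
    rw [div_le_one (by positivity), sqrt_le_left (by positivity)]
    nlinarith [sq_nonneg (cosh (c / 2))]
  have hpos' : 0 < cosh (l / 2) := cosh_pos _
  have hlower : 0 ≤ sinh (c / 2) / cosh (c / 2) *
      (√(cosh (l / 2) ^ 2 - cosh (c / 2) ^ 2) / (cosh (l / 2) + 1)) := by positivity
  have hupper := mul_le_one₀ hratio (by positivity) hroot
  have := strictAntiOn_arccos ⟨by linarith, by linarith⟩ ⟨by linarith, hupper⟩ hlt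
  linarith
end

section
/- Let 0 < a < b be real numbers, and define f(x) = π/2 + arcsin(2ax/(x² + a²)) + arccos(2bx/(x² + b²)) for x > b. Then f is differentiable on (b, ∞) with f′(x) = 2(x² − ab)(b − a)/((a² + x²)(b² + x²)); in particular f′(x) > 0 for all x > b, so f is strictly increasing on (b, ∞). -/
open Real

/-- The derivative of `arcsin (2cx/(x²+c²))` on `(c, ∞)`, where it equals `2 arctan (c/x)`. -/
theorem hasDerivAt_arcsin_two_mul_div {c x : ℝ} (hc : 0 < c) (hx : c < x) :
    HasDerivAt (fun y : ℝ => arcsin (2 * c * y / (y ^ 2 + c ^ 2)))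
      (-(2 * c / (x ^ 2 + c ^ 2))) x := by
  have hx0 : 0 < x := hc.trans hx
  have hs : 0 < x ^ 2 + c ^ 2 := by positivity
  have hd : 0 < x ^ 2 - c ^ 2 := by nlinarith
  have hlt : 2 * c * x / (x ^ 2 + c ^ 2) < 1 := by
    rw [div_lt_one hs]
    nlinarith [mul_pos (sub_pos.2 hx) (sub_pos.2 hx)]
  have hpos : 0 < 2 * c * x / (x ^ 2 + c ^ 2) := by positivity
  have hsqrt : √(1 - (2 * c * x / (x ^ 2 + c ^ 2)) ^ 2) = (x ^ 2 - c ^ 2) / (x ^ 2 + c ^ 2) := by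
    rw [Real.sqrt_eq_iff_mul_self_eq_of_pos (by positivity)]
    field_simp
    ring
  have hnum : HasDerivAt (fun y : ℝ => 2 * c * y) (2 * c) x := by
    simpa using (hasDerivAt_id x).const_mul (2 * c)
  have hden : HasDerivAt (fun y : ℝ => y ^ 2 + c ^ 2) (2 * x) x := by
    simpa using (hasDerivAt_pow 2 x).add_const (c ^ 2)
  have harg := hnum.fun_div hden hs.ne'
  have h := (hasDerivAt_arcsin (by linarith) hlt.ne).comp x harg
  refine h.congr_deriv ?_
  rw [hsqrt]
  field_simp
  ring

/-- For `0 < a < b`, the angle-sum function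
`f(x) = π/2 + arcsin (2ax/(x²+a²)) + arccos (2bx/(x²+b²))` on `(b, ∞)` has derivative
`2(x² − ab)(b − a)/((a²+x²)(b²+x²))`, which is positive, so `f` is strictly increasing. -/
theorem stmt_5 (a b : ℝ) (ha : 0 < a) (hab : a < b)
    (f : ℝ → ℝ)
    (hf : ∀ x : ℝ, f x =
      π / 2 + arcsin (2 * a * x / (x ^ 2 + a ^ 2)) + arccos (2 * b * x / (x ^ 2 + b ^ 2))) :
    (∀ x ∈ Set.Ioi b,
      HasDerivAt f (2 * (x ^ 2 - a * b) * (b - a) / ((a ^ 2 + x ^ 2) * (b ^ 2 + x ^ 2))) x) ∧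
    (∀ x ∈ Set.Ioi b,
      0 < 2 * (x ^ 2 - a * b) * (b - a) / ((a ^ 2 + x ^ 2) * (b ^ 2 + x ^ 2))) ∧
    StrictMonoOn f (Set.Ioi b) := by
  have hderiv : ∀ x ∈ Set.Ioi b,
      HasDerivAt f (2 * (x ^ 2 - a * b) * (b - a) / ((a ^ 2 + x ^ 2) * (b ^ 2 + x ^ 2))) x := by
    intro x hx
    have hb : 0 < b := ha.trans hab
    have hx0 : 0 < x := hb.trans hx
    obtain rfl : f = fun x => π / 2 + arcsin (2 * a * x / (x ^ 2 + a ^ 2)) +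
        (π / 2 - arcsin (2 * b * x / (x ^ 2 + b ^ 2))) := funext hf
    refine (((hasDerivAt_arcsin_two_mul_div ha (hab.trans hx)).const_add (π / 2)).fun_add
      ((hasDerivAt_arcsin_two_mul_div hb hx).const_sub (π / 2))).congr_deriv ?_
    field_simp
    ring
  have hpos : ∀ x ∈ Set.Ioi b,
      0 < 2 * (x ^ 2 - a * b) * (b - a) / ((a ^ 2 + x ^ 2) * (b ^ 2 + x ^ 2)) := by
    intro x hx
    have hbx : b < x := hx
    have hnum : 0 < x ^ 2 - a * b := by nlinarith
    have hba : 0 < b - a := sub_pos.2 hab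
    have hb : 0 < b := ha.trans hab
    positivity
  refine ⟨hderiv, hpos, strictMonoOn_of_deriv_pos (convex_Ioi b)
    (fun x hx => (hderiv x hx).continuousAt.continuousWithinAt) fun x hx => ?_⟩
  rw [interior_Ioi] at hx
  rw [(hderiv x hx).deriv]
  exact hpos x hx
end

section
/- Let 0 < a < b be real numbers. Then 2 · arcsin(2√(ab)/(a + b)) < π/2 + arcsin(2ab/(a² + b²)). -/
open Real

/-- The minimal angle sum `2 · arcsin (2√(ab)/(a + b))` is strictly smaller than the
common boundary value `π/2 + arcsin (2ab/(a² + b²))`. -/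
theorem stmt_9 (a b : ℝ) (ha : 0 < a) (hab : a < b) :
    2 * arcsin (2 * Real.sqrt (a * b) / (a + b)) <
      π / 2 + arcsin (2 * a * b / (a ^ 2 + b ^ 2)) := by
  have hb : 0 < b := ha.trans hab
  have hp : 0 < a * b := mul_pos ha hb
  have hS : 0 < a ^ 2 + b ^ 2 := by positivity
  have hsq : (2 * √(a * b) / (a + b)) ^ 2 = 4 * (a * b) / (a + b) ^ 2 := by
    rw [div_pow, mul_pow, Real.sq_sqrt hp.le]
    norm_num
  have hs0 : 0 ≤ 2 * √(a * b) / (a + b) := by positivity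
  have hs1 : 2 * √(a * b) / (a + b) ≤ 1 := by
    refine (sq_le_one_iff₀ hs0).1 ?_
    rw [hsq, div_le_one (by positivity)]
    nlinarith [sq_nonneg (a - b)]
  have hu0 := arcsin_nonneg.2 hs0
  have hu1 := arcsin_le_pi_div_two (2 * √(a * b) / (a + b))
  have hsin : sin (2 * arcsin (2 * √(a * b) / (a + b)) - π / 2) =
      8 * (a * b) / (a + b) ^ 2 - 1 := by
    rw [sin_sub_pi_div_two, cos_two_mul, cos_sq', sin_arcsin (by linarith) hs1, hsq]
    ring
  rw [← sub_lt_iff_lt_add', lt_arcsin_iff_sin_lt ⟨by linarith, by linarith⟩, hsin]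
  · rw [sub_lt_iff_lt_add, div_add_one hS.ne', div_lt_div_iff₀ (by positivity) hS]
    have h : 0 < ((b - a) ^ 2) ^ 2 := by
      have := sub_pos.2 hab
      positivity
    linarith
  · refine ⟨(by norm_num : (-1 : ℝ) ≤ 0).trans (by positivity), ?_⟩
    rw [div_le_one hS]
    exact two_mul_le_add_sq a b
end

section
/- Let 0 < a < b be real numbers, and define Φ : (0, ∞) → ℝ piecewise by Φ(x) = π/2 + arccos(2ax/(x² + a²)) + arcsin(2bx/(x² + b²)) for 0 < x ≤ a, Φ(x) = arcsin(2ax/(x² + a²)) + arcsin(2bx/(x² + b²)) for a ≤ x ≤ b, and Φ(x) = π/2 + arcsin(2ax/(x² + a²)) + arccos(2bx/(x² + b²)) for x ≥ b (the definitions agree at x = a and x = b). Then Φ attains a strict global minimum at x = √(ab): Φ(√(ab)) < Φ(x) for every x > 0 with x ≠ √(ab). (Equivalently: the hyperbolic triangle with vertices ai, bi on the imaginary axis and ideal vertex x on the positive real axis has maximal area exactly when x = √(ab).) -/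
open Real

theorem sin_two_mul_arctan_div {c x : ℝ} (hc : 0 < c) :
    sin (2 * arctan (x / c)) = 2 * c * x / (x ^ 2 + c ^ 2) := by
  have h : 0 < 1 + (x / c) ^ 2 := by positivity
  have hd : x ^ 2 + c ^ 2 ≠ 0 := by positivity
  rw [sin_two_mul, sin_arctan, cos_arctan, mul_assoc, div_mul_div_comm, mul_self_sqrt h.le]
  field_simp
  ring

theorem arcsin_eq_two_mul_arctan_div {c x : ℝ} (hc : 0 < c) (hx : 0 ≤ x) (hxc : x ≤ c) :
    arcsin (2 * c * x / (x ^ 2 + c ^ 2)) = 2 * arctan (x / c) := by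
  have h0 : 0 ≤ arctan (x / c) := arctan_nonneg.2 (by positivity)
  have h1 : arctan (x / c) ≤ π / 4 := by
    rw [← arctan_one]
    exact arctan_strictMono.monotone ((div_le_one hc).2 hxc)
  rw [← sin_two_mul_arctan_div hc, arcsin_sin] <;> linarith [pi_pos]

theorem arcsin_eq_pi_sub_two_mul_arctan_div {c x : ℝ} (hc : 0 < c) (hcx : c ≤ x) :
    arcsin (2 * c * x / (x ^ 2 + c ^ 2)) = π - 2 * arctan (x / c) := by
  have h1 : π / 4 ≤ arctan (x / c) := by
    rw [← arctan_one]
    exact arctan_strictMono.monotone ((one_le_div hc).2 hcx)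
  have h2 := arctan_lt_pi_div_two (x / c)
  rw [← sin_two_mul_arctan_div hc, ← sin_pi_sub, arcsin_sin] <;> linarith

theorem arctan_div_sub_arctan_div {a b x : ℝ} (ha : 0 < a) (hb : 0 < b) :
    arctan (x / a) - arctan (x / b) = arctan ((b - a) * (x / (x ^ 2 + a * b))) := by
  have hlt : x / a * -(x / b) < 1 := by
    have : 0 ≤ x / a * (x / b) := by
      rw [div_mul_div_comm]
      exact div_nonneg (mul_self_nonneg x) (by positivity)
    linarith
  rw [sub_eq_add_neg, ← arctan_neg, arctan_add hlt]
  congr 1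
  have h1 : x ^ 2 + a * b ≠ 0 := by positivity
  have h2 : 1 - x / a * -(x / b) ≠ 0 := by linarith
  rw [div_eq_iff h2]
  field_simp
  ring

theorem div_sq_add_lt_of_ne_sqrt {p x : ℝ} (hp : 0 < p) (hx : x ≠ √p) :
    x / (x ^ 2 + p) < √p / (√p ^ 2 + p) := by
  have hs : 0 < √p := sqrt_pos.2 hp
  have hsq : √p ^ 2 = p := sq_sqrt hp.le
  have hne : 0 < (x - √p) ^ 2 := by
    have := sub_ne_zero.2 hx
    positivity
  rw [div_lt_div_iff₀ (by positivity) (by positivity)]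
  have key : √p * (x ^ 2 + p) - x * (√p ^ 2 + p) = √p * (x - √p) ^ 2 := by
    linear_combination (x - √p) * hsq
  linarith [mul_pos hs hne]

/-- The piecewise angle-sum function `Φ` of the hyperbolic triangle with vertices `ai`, `bi`
and ideal vertex `x > 0` is well defined (the pieces agree at `x = a` and `x = b`) and
attains a strict global minimum on `(0, ∞)` at `x = √(ab)`. -/
theorem stmt_10 (a b : ℝ) (ha : 0 < a) (hab : a < b)
    (Φ : ℝ → ℝ)
    (hΦ : ∀ x : ℝ, Φ x =
      if x ≤ a then
        π / 2 + arccos (2 * a * x / (x ^ 2 + a ^ 2)) + arcsin (2 * b * x / (x ^ 2 + b ^ 2))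
      else if x ≤ b then
        arcsin (2 * a * x / (x ^ 2 + a ^ 2)) + arcsin (2 * b * x / (x ^ 2 + b ^ 2))
      else
        π / 2 + arcsin (2 * a * x / (x ^ 2 + a ^ 2)) + arccos (2 * b * x / (x ^ 2 + b ^ 2))) :
    (π / 2 + arccos (2 * a * a / (a ^ 2 + a ^ 2)) + arcsin (2 * b * a / (a ^ 2 + b ^ 2)) =
      arcsin (2 * a * a / (a ^ 2 + a ^ 2)) + arcsin (2 * b * a / (a ^ 2 + b ^ 2))) ∧
    (arcsin (2 * a * b / (b ^ 2 + a ^ 2)) + arcsin (2 * b * b / (b ^ 2 + b ^ 2)) =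
      π / 2 + arcsin (2 * a * b / (b ^ 2 + a ^ 2)) + arccos (2 * b * b / (b ^ 2 + b ^ 2))) ∧
    (∀ x : ℝ, 0 < x → x ≠ Real.sqrt (a * b) → Φ (Real.sqrt (a * b)) < Φ x) := by
  have hb : 0 < b := ha.trans hab
  have ha1 : 2 * a * a / (a ^ 2 + a ^ 2) = 1 := by field_simp; ring
  have hb1 : 2 * b * b / (b ^ 2 + b ^ 2) = 1 := by field_simp; ring
  have hform : ∀ x : ℝ, 0 < x → Φ x = π - 2 * arctan ((b - a) * (x / (x ^ 2 + a * b))) := by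
    intro x hx
    rw [hΦ, ← arctan_div_sub_arctan_div ha hb]
    split_ifs with h1 h2
    · rw [arccos, arcsin_eq_two_mul_arctan_div ha hx.le h1,
        arcsin_eq_two_mul_arctan_div hb hx.le (h1.trans hab.le)]
      ring
    · rw [arcsin_eq_pi_sub_two_mul_arctan_div ha (not_le.1 h1).le,
        arcsin_eq_two_mul_arctan_div hb hx.le h2]
      ring
    · rw [arccos, arcsin_eq_pi_sub_two_mul_arctan_div ha (not_le.1 h1).le,
        arcsin_eq_pi_sub_two_mul_arctan_div hb (not_le.1 h2).le]
      ring
  refine ⟨by rw [ha1, arccos_one, arcsin_one]; ring, by rw [hb1, arccos_one, arcsin_one]; ring, ?_⟩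
  intro x hx hne
  have hab0 : 0 < a * b := mul_pos ha hb
  rw [hform x hx, hform _ (sqrt_pos.2 hab0)]
  have := arctan_strictMono
    (mul_lt_mul_of_pos_left (div_sq_add_lt_of_ne_sqrt hab0 hne) (sub_pos.2 hab))
  linarith
end

section
/- For every real number x > 4, one has 2x · ln(√2 · cos(π/x) + √(cos(2π/x))) > 2(x − 4) · ln(√2 + 1), and at x = 4 both sides are equal (to 0). Here √2 · cos(π/x) ≥ 1 and cos(2π/x) ≥ 0 for all x ≥ 4, so the expression ln(√2 · cos(π/x) + √(cos(2π/x))) equals arccosh(√2 · cos(π/x)) and is well defined and nonnegative. -/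
open Real

theorem one_le_sqrt_two_mul_cos {t : ℝ} (h0 : 0 ≤ t) (h1 : t ≤ π / 4) : 1 ≤ √2 * cos t := by
  have h : cos (π / 4) ≤ cos t := cos_le_cos_of_nonneg_of_le_pi h0 (by linarith [pi_pos]) h1
  rw [cos_pi_div_four] at h
  nlinarith [mul_le_mul_of_nonneg_left h (sqrt_nonneg 2), Real.sq_sqrt (zero_le_two (α := ℝ))]

theorem hasDerivAt_log_sqrt_two_mul_cos_add_sqrt {t : ℝ} (h0 : 0 < t) (h1 : t < π / 4) :
    HasDerivAt (fun t ↦ log (√2 * cos t + √(cos (2 * t)))) (-(√2 * (sin t / √(cos (2 * t))))) t := by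
  have hc : 0 < cos (2 * t) := cos_pos_of_mem_Ioo ⟨by linarith [pi_pos], by linarith⟩
  have hs : 0 < √(cos (2 * t)) := sqrt_pos.2 hc
  have hpos : 0 < √2 * cos t + √(cos (2 * t)) := by
    linarith [one_le_sqrt_two_mul_cos h0.le h1.le]
  have hd : HasDerivAt (fun t ↦ cos (2 * t)) (-sin (2 * t) * 2) t := by
    simpa using ((hasDerivAt_id t).const_mul 2).cos
  convert (((hasDerivAt_cos t).const_mul √2).fun_add (hd.sqrt hc.ne')).log hpos.ne' using 1
  rw [sin_two_mul, eq_div_iff hpos.ne']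
  field_simp
  linear_combination (-(sin t * cos t)) * Real.sq_sqrt (zero_le_two (α := ℝ))

theorem strictConcaveOn_log_sqrt_two_mul_cos_add_sqrt :
    StrictConcaveOn ℝ (Set.Icc 0 (π / 4)) (fun t ↦ log (√2 * cos t + √(cos (2 * t)))) := by
  refine StrictAntiOn.strictConcaveOn_of_deriv (convex_Icc _ _) ?_ ?_
  · refine ContinuousOn.log (by fun_prop) fun t ht ↦ ne_of_gt ?_
    linarith [one_le_sqrt_two_mul_cos ht.1 ht.2, sqrt_nonneg (cos (2 * t))]
  · rw [interior_Icc]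
    intro a ha b hb hab
    rw [(hasDerivAt_log_sqrt_two_mul_cos_add_sqrt ha.1 ha.2).deriv,
      (hasDerivAt_log_sqrt_two_mul_cos_add_sqrt hb.1 hb.2).deriv, neg_lt_neg_iff]
    have hpi := pi_pos
    have hc : 0 < cos (2 * b) :=
      cos_pos_of_mem_Ioo ⟨by linarith [hb.1], by linarith [hb.2]⟩
    have hcos : cos (2 * b) ≤ cos (2 * a) :=
      cos_le_cos_of_nonneg_of_le_pi (by linarith [ha.1]) (by linarith [hb.2]) (by linarith)
    have hsin : sin a < sin b :=
      sin_lt_sin_of_lt_of_le_pi_div_two (by linarith [ha.1]) (by linarith [hb.2]) hab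
    have hsin_nonneg : 0 ≤ sin b := sin_nonneg_of_nonneg_of_le_pi hb.1.le (by linarith [hb.2])
    exact mul_lt_mul_of_pos_left
      (div_lt_div₀ hsin (sqrt_le_sqrt hcos) hsin_nonneg (sqrt_pos.2 hc)) (by positivity)

/-- For `x ≥ 4` one has `√2 cos (π/x) ≥ 1` and `cos (2π/x) ≥ 0`; for every `x > 4`
the perimeter of the regular right-angled hyperbolic `x`-gon exceeds the perimeter of the
regular right-angled `(x−4)`-sided polygonal cusp, with equality (both `0`) at `x = 4`. -/
theorem stmt_13 :
    (∀ x : ℝ, 4 ≤ x → 1 ≤ Real.sqrt 2 * Real.cos (π / x) ∧ 0 ≤ Real.cos (2 * π / x)) ∧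
    (∀ x : ℝ, 4 < x →
      2 * x * Real.log (Real.sqrt 2 * Real.cos (π / x) + Real.sqrt (Real.cos (2 * π / x))) >
        2 * (x - 4) * Real.log (Real.sqrt 2 + 1)) ∧
    2 * (4 : ℝ) *
        Real.log (Real.sqrt 2 * Real.cos (π / 4) + Real.sqrt (Real.cos (2 * π / 4))) = 0 ∧
    2 * ((4 : ℝ) - 4) * Real.log (Real.sqrt 2 + 1) = 0 := by
  have hpi := pi_pos
  have hend : log (√2 * cos (π / 4) + √(cos (2 * (π / 4)))) = 0 := by
    rw [show 2 * (π / 4) = π / 2 by ring, cos_pi_div_two, cos_pi_div_four, sqrt_zero,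
      ← mul_div_assoc, mul_self_sqrt zero_le_two]
    simp
  refine ⟨fun x hx ↦ ?_, fun x hx ↦ ?_, ?_, by simp⟩
  · have ht : π / x ≤ π / 4 := div_le_div_of_nonneg_left hpi.le (by norm_num) hx
    have h0 : 0 ≤ π / x := by positivity
    rw [mul_div_assoc]
    exact ⟨one_le_sqrt_two_mul_cos h0 ht,
      cos_nonneg_of_mem_Icc ⟨by linarith, by linarith⟩⟩
  · have hx0 : 0 < x := by linarith
    have h := strictConcaveOn_log_sqrt_two_mul_cos_add_sqrt.2
      (Set.left_mem_Icc.2 (by positivity)) (Set.right_mem_Icc.2 (by positivity))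
      (by positivity : (0 : ℝ) < π / 4).ne
      (div_pos (sub_pos.2 hx) hx0) (div_pos (zero_lt_four (α := ℝ)) hx0) (by field_simp; ring)
    simp only [smul_eq_mul, hend, mul_zero, cos_zero, sqrt_one, mul_one, zero_add, add_zero] at h
    rw [show 4 / x * (π / 4) = π / x by field_simp, ← mul_div_assoc, div_mul_eq_mul_div,
      div_lt_iff₀ hx0] at h
    linarith
  · rw [mul_div_assoc, hend, mul_zero]
end

section
/- The function f(x) = 2x · ln(√2 · cos(π/x) + √(cos(2π/x))) is twice differentiable on (4, ∞), and its second derivative satisfies f″(x) = −(2π²√2 · cos(π/x))/(x³ · (cos(2π/x))^{3/2}) for every x > 4; in particular f″(x) < 0 on (4, ∞), so f is strictly concave on (4, ∞). -/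
open Real

lemma cos_two_mul_pos_of_mem_Ioo {t : ℝ} (h0 : 0 < t) (h1 : t < π / 4) : 0 < cos (2 * t) :=
  cos_pos_of_mem_Ioo ⟨by linarith [pi_pos], by linarith⟩

lemma hasDerivAt_sqrt_cos_two_mul {t : ℝ} (hc : 0 < cos (2 * t)) :
    HasDerivAt (fun s => √(cos (2 * s))) (-sin (2 * t) / √(cos (2 * t))) t := by
  have h := (((hasDerivAt_id t).const_mul 2).cos).sqrt hc.ne'
  refine h.congr_deriv ?_
  have := (sqrt_pos.2 hc).ne'
  simp only [id]
  field_simp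

/-- The derivative of `arcosh (√2 cos t)`, written out with the logarithm. -/
lemma hasDerivAt_log_sqrt_two_mul_cos_add {t : ℝ} (hcos : 0 < cos t) (hc : 0 < cos (2 * t)) :
    HasDerivAt (fun s => log (√2 * cos s + √(cos (2 * s))))
      (-(√2 * (sin t / √(cos (2 * t))))) t := by
  have hq : 0 < √(cos (2 * t)) := sqrt_pos.2 hc
  have hu : 0 < √2 * cos t + √(cos (2 * t)) := by positivity
  have h := (((hasDerivAt_cos t).const_mul √2).add (hasDerivAt_sqrt_cos_two_mul hc)).log hu.ne'
  refine h.congr_deriv ?_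
  have h2 : √2 * √2 = 2 := mul_self_sqrt (by norm_num)
  rw [Pi.add_apply, div_eq_iff hu.ne']
  field_simp
  rw [sin_two_mul]
  linear_combination sin t * cos t * h2

lemma hasDerivAt_sin_div_sqrt_cos_two_mul {t : ℝ} (hc : 0 < cos (2 * t)) :
    HasDerivAt (fun s => sin s / √(cos (2 * s))) (cos t / cos (2 * t) ^ ((3 : ℝ) / 2)) t := by
  have hq : 0 < √(cos (2 * t)) := sqrt_pos.2 hc
  have h := (hasDerivAt_sin t).div (hasDerivAt_sqrt_cos_two_mul hc) hq.ne'
  refine h.congr_deriv ?_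
  have hpow : cos (2 * t) ^ ((3 : ℝ) / 2) = √(cos (2 * t)) ^ 3 := by
    rw [sqrt_eq_rpow, ← rpow_mul_natCast hc.le]
    norm_num
  have hsq : √(cos (2 * t)) ^ 2 = cos (2 * t) := sq_sqrt hc.le
  rw [hpow]
  field_simp
  rw [hsq, sin_two_mul, cos_two_mul]
  linear_combination 2 * cos t * sin_sq_add_cos_sq t

lemma hasDerivAt_const_div {c x : ℝ} (hx : x ≠ 0) :
    HasDerivAt (fun y => c / y) (-c / x ^ 2) x := by
  refine ((hasDerivAt_const x c).fun_div (hasDerivAt_id' x) hx).congr_deriv ?_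
  simp

theorem stmt_14 (f : ℝ → ℝ)
    (hf : ∀ x : ℝ, f x =
      2 * x * Real.log (Real.sqrt 2 * Real.cos (π / x) + Real.sqrt (Real.cos (2 * π / x)))) :
    DifferentiableOn ℝ f (Set.Ioi (4 : ℝ)) ∧
    DifferentiableOn ℝ (deriv f) (Set.Ioi (4 : ℝ)) ∧
    (∀ x : ℝ, 4 < x → deriv (deriv f) x =
      -(2 * π ^ 2 * Real.sqrt 2 * Real.cos (π / x)) /
        (x ^ 3 * Real.cos (2 * π / x) ^ ((3 : ℝ) / 2))) ∧
    (∀ x : ℝ, 4 < x → deriv (deriv f) x < 0) ∧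
    StrictConcaveOn ℝ (Set.Ioi (4 : ℝ)) f := by
  set g : ℝ → ℝ := fun s => log (√2 * cos s + √(cos (2 * s))) with hg
  set h : ℝ → ℝ := fun s => sin s / √(cos (2 * s))
  have hfg : f = fun x => 2 * x * g (π / x) := by
    funext x
    rw [hf, hg, mul_div_assoc]
  have hpos : ∀ x : ℝ, 4 < x → 0 < cos (π / x) ∧ 0 < cos (2 * (π / x)) := by
    intro x hx
    have h0 : 0 < π / x := div_pos pi_pos (by linarith)
    have h1 : π / x < π / 4 := div_lt_div_of_pos_left pi_pos (by norm_num) hx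
    exact ⟨cos_pos_of_mem_Ioo ⟨by linarith [pi_pos], by linarith [pi_pos]⟩,
      cos_two_mul_pos_of_mem_Ioo h0 h1⟩
  have hgx : ∀ x : ℝ, 4 < x →
      HasDerivAt (fun y => g (π / y)) (-(√2 * h (π / x)) * (-π / x ^ 2)) x := fun x hx =>
    (hasDerivAt_log_sqrt_two_mul_cos_add (hpos x hx).1 (hpos x hx).2).comp x
      (hasDerivAt_const_div (by linarith))
  have hd : ∀ x : ℝ, 4 < x →
      HasDerivAt f (2 * g (π / x) + 2 * √2 * (π / x * h (π / x))) x := by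
    intro x hx
    have hx0 : x ≠ 0 := by linarith
    rw [hfg]
    refine (((hasDerivAt_id x).const_mul 2).mul (hgx x hx)).congr_deriv ?_
    simp only [id]
    field_simp
  have hdd : ∀ x : ℝ, 4 < x → HasDerivAt (deriv f)
      (-(2 * π ^ 2 * √2 * cos (π / x)) / (x ^ 3 * cos (2 * π / x) ^ ((3 : ℝ) / 2))) x := by
    intro x hx
    have hx0 : x ≠ 0 := by linarith
    have hev : deriv f =ᶠ[nhds x] fun y => 2 * g (π / y) + 2 * √2 * (π / y * h (π / y)) := by
      filter_upwards [Ioi_mem_nhds hx] with y hy using (hd y hy).deriv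
    refine HasDerivAt.congr_of_eventuallyEq ?_ hev
    have hhx : HasDerivAt (fun y => h (π / y)) _ x :=
      (hasDerivAt_sin_div_sqrt_cos_two_mul (hpos x hx).2).comp x (hasDerivAt_const_div hx0)
    refine (((hgx x hx).const_mul 2).add
      (((hasDerivAt_const_div (c := π) hx0).mul hhx).const_mul (2 * √2))).congr_deriv ?_
    have hr : cos (2 * (π / x)) ^ ((3 : ℝ) / 2) ≠ 0 := (rpow_pos_of_pos (hpos x hx).2 _).ne'
    rw [mul_div_assoc 2 π x]
    generalize cos (2 * (π / x)) ^ ((3 : ℝ) / 2) = r at *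
    generalize h (π / x) = k
    generalize cos (π / x) = c
    field_simp
    ring
  have hneg : ∀ x : ℝ, 4 < x → deriv (deriv f) x < 0 := by
    intro x hx
    obtain ⟨h1, h2⟩ := hpos x hx
    have hx0 : 0 < x := by linarith
    rw [(hdd x hx).deriv, neg_div, mul_div_assoc 2 π x]
    exact neg_neg_of_pos (by positivity)
  refine ⟨fun x hx => (hd x hx).differentiableAt.differentiableWithinAt,
    fun x hx => (hdd x hx).differentiableAt.differentiableWithinAt,
    fun x hx => (hdd x hx).deriv, hneg, ?_⟩
  exact strictConcaveOn_of_deriv2_neg' (convex_Ioi 4)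
    (fun x hx => (hd x hx).continuousAt.continuousWithinAt) hneg
end

section
/- Define h(x) = 2x · ( ln(√2 · cos(π/x) + √(cos(2π/x))) − ln(√2 + 1) ) + 8 · ln(√2 + 1) for x ≥ 4. Then h is differentiable on (4, ∞), its derivative h′ is strictly decreasing on (4, ∞), h′(x) → 0 as x → ∞, and consequently h′(x) > 0 for every x > 4; hence h is strictly increasing on (4, ∞) and, since h(4) = 0, one has h(x) > 0 for all x > 4. -/
open Real

lemma cos_two_mul_pos_of_mem {t : ℝ} (h0 : 0 ≤ t) (h1 : t < π / 4) : 0 < Real.cos (2 * t) :=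
  Real.cos_pos_of_mem_Ioo ⟨by linarith [Real.pi_pos], by linarith⟩

lemma cos_pos_of_mem {t : ℝ} (h0 : 0 ≤ t) (h1 : t < π / 4) : 0 < Real.cos t :=
  Real.cos_pos_of_mem_Ioo ⟨by linarith [Real.pi_pos], by linarith [Real.pi_pos]⟩

/-- The half-length `arccosh (√2 cos t)` of an edge of the right-angled polygon with `π / t` sides,
as a function of `t`. -/
noncomputable def halfSide (t : ℝ) : ℝ :=
  Real.log (Real.sqrt 2 * Real.cos t + Real.sqrt (Real.cos (2 * t)))

lemma hasDerivAt_sqrt_cos_two_mul_s15 {t : ℝ} (h : 0 < Real.cos (2 * t)) :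
    HasDerivAt (fun t => Real.sqrt (Real.cos (2 * t)))
      (-(2 * Real.sin t * Real.cos t) / Real.sqrt (Real.cos (2 * t))) t := by
  have h2 : HasDerivAt (fun t : ℝ => 2 * t) 2 t := by
    simpa using (hasDerivAt_id t).const_mul 2
  convert (h2.cos).sqrt h.ne' using 1
  rw [Real.sin_two_mul]
  ring

lemma hasDerivAt_halfSide {t : ℝ} (h0 : 0 ≤ t) (h1 : t < π / 4) :
    HasDerivAt halfSide (-(Real.sqrt 2 * Real.sin t / Real.sqrt (Real.cos (2 * t)))) t := by
  have hc := cos_two_mul_pos_of_mem h0 h1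
  have hc' := cos_pos_of_mem h0 h1
  have hS : 0 < Real.sqrt (Real.cos (2 * t)) := Real.sqrt_pos.2 hc
  have h2 : 0 < Real.sqrt 2 := by positivity
  have hsum : 0 < Real.sqrt 2 * Real.cos t + Real.sqrt (Real.cos (2 * t)) := by positivity
  have h22 : Real.sqrt 2 ^ 2 = 2 := Real.sq_sqrt (by norm_num)
  refine ((((Real.hasDerivAt_cos t).const_mul (Real.sqrt 2)).add
    (hasDerivAt_sqrt_cos_two_mul_s15 hc)).log hsum.ne').congr_deriv ?_
  simp only [Pi.add_apply]
  field_simp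
  linear_combination (Real.sin t * Real.cos t) * h22

/-- The derivative of `h` at `x` in terms of `t = π / x`. -/
noncomputable def perimeterSlope (t : ℝ) : ℝ :=
  2 * (halfSide t - Real.log (Real.sqrt 2 + 1) +
    t * (Real.sqrt 2 * Real.sin t / Real.sqrt (Real.cos (2 * t))))

lemma hasDerivAt_perimeterSlope {t : ℝ} (h0 : 0 ≤ t) (h1 : t < π / 4) :
    HasDerivAt perimeterSlope
      (2 * (t * (Real.sqrt 2 * Real.cos t / Real.sqrt (Real.cos (2 * t)) ^ 3))) t := by
  have hc := cos_two_mul_pos_of_mem h0 h1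
  have hS : 0 < Real.sqrt (Real.cos (2 * t)) := Real.sqrt_pos.2 hc
  have hS2 : Real.sqrt (Real.cos (2 * t)) ^ 2 = 2 * Real.cos t ^ 2 - 1 := by
    rw [Real.sq_sqrt hc.le, Real.cos_two_mul]
  have hq := ((Real.hasDerivAt_sin t).const_mul (Real.sqrt 2)).div
    (hasDerivAt_sqrt_cos_two_mul_s15 hc) hS.ne'
  refine ((((hasDerivAt_halfSide h0 h1).sub_const (Real.log (Real.sqrt 2 + 1))).add
    ((hasDerivAt_id t).mul hq)).const_mul 2).congr_deriv ?_
  simp only [id, Pi.div_apply]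
  field_simp
  linear_combination (t * Real.cos t) * hS2 + 2 * t * Real.cos t * Real.sin_sq_add_cos_sq t

lemma strictMonoOn_perimeterSlope : StrictMonoOn perimeterSlope (Set.Ico 0 (π / 4)) := by
  refine strictMonoOn_of_deriv_pos (convex_Ico _ _)
    (fun t ht => (hasDerivAt_perimeterSlope ht.1 ht.2).continuousAt.continuousWithinAt) fun t ht => ?_
  rw [interior_Ico] at ht
  rw [(hasDerivAt_perimeterSlope ht.1.le ht.2).deriv]
  have hS := Real.sqrt_pos.2 (cos_two_mul_pos_of_mem ht.1.le ht.2)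
  have hc := cos_pos_of_mem ht.1.le ht.2
  have ht0 := ht.1
  positivity

lemma perimeterSlope_zero : perimeterSlope 0 = 0 := by
  simp [perimeterSlope, halfSide]

lemma pi_div_mem_Ico {x : ℝ} (hx : 4 < x) : π / x ∈ Set.Ico 0 (π / 4) :=
  ⟨by have := Real.pi_pos; positivity, div_lt_div_of_pos_left Real.pi_pos (by norm_num) hx⟩

/-- Properties of `h(x) = 2x (ln (√2 cos (π/x) + √(cos (2π/x))) − ln (√2 + 1)) + 8 ln (√2 + 1)`:
`h` is differentiable on `(4, ∞)`, `h′` is strictly decreasing there and tends to `0`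
at infinity, hence `h′ > 0` on `(4, ∞)`, so `h` is strictly increasing on `(4, ∞)`;
moreover `h(4) = 0` and `h > 0` on `(4, ∞)`. -/
theorem stmt_15 (h : ℝ → ℝ)
    (hh : ∀ x : ℝ, h x =
      2 * x * (Real.log (Real.sqrt 2 * Real.cos (π / x) + Real.sqrt (Real.cos (2 * π / x))) -
        Real.log (Real.sqrt 2 + 1)) + 8 * Real.log (Real.sqrt 2 + 1)) :
    DifferentiableOn ℝ h (Set.Ioi (4 : ℝ)) ∧
    StrictAntiOn (deriv h) (Set.Ioi (4 : ℝ)) ∧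
    Filter.Tendsto (deriv h) Filter.atTop (nhds 0) ∧
    (∀ x : ℝ, 4 < x → 0 < deriv h x) ∧
    StrictMonoOn h (Set.Ioi (4 : ℝ)) ∧
    h 4 = 0 ∧
    (∀ x : ℝ, 4 < x → 0 < h x) := by
  have hA : h = fun x => 2 * x * (halfSide (π / x) - Real.log (Real.sqrt 2 + 1)) +
      8 * Real.log (Real.sqrt 2 + 1) := by
    funext x
    rw [hh, halfSide, mul_div_assoc]
  have hd : ∀ x : ℝ, 4 < x → HasDerivAt h (perimeterSlope (π / x)) x := by
    intro x hx
    have hx0 : x ≠ 0 := by linarith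
    have hm := pi_div_mem_Ico hx
    have hi : HasDerivAt (fun x : ℝ => π / x) (-(π / x ^ 2)) x := by
      simpa [div_eq_mul_inv] using (hasDerivAt_inv hx0).const_mul π
    have hl : HasDerivAt (fun x : ℝ => 2 * x) 2 x := by
      simpa using (hasDerivAt_id x).const_mul 2
    have hs : HasDerivAt (fun x => halfSide (π / x)) _ x :=
      (hasDerivAt_halfSide hm.1 hm.2).comp x hi
    rw [hA]
    refine ((hl.mul (hs.sub_const (Real.log (Real.sqrt 2 + 1)))).add_const
      (8 * Real.log (Real.sqrt 2 + 1))).congr_deriv ?_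
    rw [perimeterSlope]
    field_simp
  have hpos : ∀ x : ℝ, 4 < x → 0 < deriv h x := by
    intro x hx
    rw [(hd x hx).deriv, ← perimeterSlope_zero]
    exact strictMonoOn_perimeterSlope ⟨le_rfl, by positivity⟩ (pi_div_mem_Ico hx)
      (div_pos Real.pi_pos (by linarith))
  have hcont : ContinuousOn h (Set.Ici 4) := by
    intro x hx
    rcases (Set.mem_Ici.1 hx).eq_or_lt with rfl | hx'
    · have hne : Real.sqrt 2 * Real.cos (π / 4) + Real.sqrt (Real.cos (2 * (π / 4))) ≠ 0 := by
        rw [Real.cos_pi_div_four]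
        positivity
      have hcA : ContinuousAt (fun x : ℝ => halfSide (π / x)) 4 := by
        have hdiv : ContinuousAt (fun x : ℝ => π / x) 4 :=
          continuousAt_const.div continuousAt_id (by norm_num)
        have hside : ContinuousAt halfSide (π / 4) :=
          ContinuousAt.log (Continuous.continuousAt (by fun_prop)) hne
        exact ContinuousAt.comp (f := fun x : ℝ => π / x) hside hdiv
      rw [hA]
      exact ContinuousAt.continuousWithinAt (by fun_prop)
    · exact (hd x hx').continuousAt.continuousWithinAt
  have hmono : StrictMonoOn h (Set.Ici 4) := by
    refine strictMonoOn_of_deriv_pos (convex_Ici _) hcont fun x hx => ?_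
    rw [interior_Ici] at hx
    exact hpos x hx
  have h4 : h 4 = 0 := by
    have e : 2 * π / 4 = π / 2 := by ring
    rw [hh, e, Real.cos_pi_div_two, Real.cos_pi_div_four, mul_div_assoc',
      Real.mul_self_sqrt (by norm_num)]
    norm_num
  refine ⟨fun x hx => (hd x hx).differentiableAt.differentiableWithinAt, ?_, ?_, hpos,
    hmono.mono Set.Ioi_subset_Ici_self, h4, ?_⟩
  · intro x hx y hy hxy
    have hx' : (4 : ℝ) < x := hx
    rw [(hd x hx).deriv, (hd y hy).deriv]
    exact strictMonoOn_perimeterSlope (pi_div_mem_Ico hy) (pi_div_mem_Ico hx)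
      (div_lt_div_of_pos_left Real.pi_pos (by linarith) hxy)
  · have hlim : Filter.Tendsto (fun x : ℝ => perimeterSlope (π / x)) Filter.atTop (nhds 0) := by
      have hs := (hasDerivAt_perimeterSlope le_rfl (by positivity : (0 : ℝ) < π / 4)).continuousAt.tendsto
      rw [perimeterSlope_zero] at hs
      exact hs.comp (tendsto_const_nhds.div_atTop Filter.tendsto_id)
    refine hlim.congr' ?_
    filter_upwards [Filter.eventually_gt_atTop 4] with x hx
    exact (hd x hx).deriv.symm
  · intro x hx
    rw [← h4]
    exact hmono Set.self_mem_Ici hx.le hx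
end

section
/- Let n₁, n₂, m be natural numbers with n₁ ≥ 5, n₂ ≥ 3, m ≥ 3 and n₁ + n₂ = m + 4. Then 2·n₁ · ln(√2 · cos(π/n₁) + √(cos(2π/n₁))) + 2·n₂ · ln(√2 + 1) ≥ 2·m · ln(√2 + 1). (In geometric terms: the perimeter of the regular right-angled hyperbolic n₁-gon plus the perimeter of the regular right-angled n₂-sided polygonal cusp is at least the perimeter of the regular right-angled m-sided polygonal cusp.) -/
open Real

/-- A quadratic lower bound, in `1 / n`, for the exponential of half the side length of the regular
right-angled hyperbolic `n`-gon. -/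
lemma sqrt_two_add_one_sub_le {n : ℝ} (hn : 5 ≤ n) :
    √2 + 1 - 26.73 / n ^ 2 ≤ √2 * cos (π / n) + √(cos (2 * π / n)) := by
  have hn0 : 0 < n := by linarith
  have hs : √2 < 1.4143 := by rw [Real.sqrt_lt' (by norm_num)]; norm_num
  have hc₁ := Real.one_sub_sq_div_two_le_cos (x := π / n)
  have hc₂ := Real.one_sub_sq_div_two_le_cos (x := 2 * π / n)
  have hc₀ : 0 ≤ cos (2 * π / n) := by
    apply Real.cos_nonneg_of_mem_Icc
    constructor
    · have : 0 ≤ 2 * π / n := by positivity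
      linarith [Real.pi_pos]
    · rw [div_le_div_iff₀ hn0 two_pos]
      nlinarith [Real.pi_pos]
  have hc₃ : cos (2 * π / n) ≤ √(cos (2 * π / n)) :=
    Real.le_sqrt_of_sq_le (by nlinarith [Real.cos_le_one (2 * π / n)])
  have hsq : (2 * π / n) ^ 2 = 4 * (π / n) ^ 2 := by ring
  have hpi : π ^ 2 ≤ 9.87 := by nlinarith [Real.pi_pos, Real.pi_lt_d4]
  have hx : (π / n) ^ 2 ≤ 9.87 / n ^ 2 := by rw [div_pow]; gcongr
  have hK : 26.73 / n ^ 2 = 26.73 / 9.87 * (9.87 / n ^ 2) := by ring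
  rw [hsq] at hc₂
  have h₁ := mul_le_mul_of_nonneg_left hc₁ (Real.sqrt_nonneg 2)
  have h₂ := mul_le_mul_of_nonneg_right hs.le (sq_nonneg (π / n))
  have h₃ := sq_nonneg (π / n)
  linarith

/-- The perimeter of the regular right-angled `n`-gon is at least `n - 4` times the side length
of a regular right-angled polygonal cusp. -/
lemma sub_four_mul_log_le {n : ℕ} (hn : 5 ≤ n) :
    ((n : ℝ) - 4) * log (√2 + 1) ≤
      n * log (√2 * cos (π / n) + √(cos (2 * π / n))) := by
  have hs : 1.4142 < √2 := Real.lt_sqrt_of_sq_lt (by norm_num)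
  have hs' : √2 < 1.4143 := by rw [Real.sqrt_lt' (by norm_num)]; norm_num
  have hn' : (5 : ℝ) ≤ n := by exact_mod_cast hn
  have hy := sqrt_two_add_one_sub_le hn'
  set y := √2 * cos (π / n) + √(cos (2 * π / n))
  rcases hn.eq_or_lt with rfl | hn6
  · norm_num at hy ⊢
    have hy1 : 1.34 ≤ y := by linarith
    have hlog := Real.one_sub_inv_le_log_of_pos (show 0 < y by linarith)
    have hinv : y⁻¹ ≤ 1.34⁻¹ := by gcongr
    have hL : log (√2 + 1) ≤ 1 := by
      rw [Real.log_le_iff_le_exp (by positivity)]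
      linarith [Real.exp_one_gt_d9]
    norm_num at hinv
    linarith
  · have hn6' : (6 : ℝ) ≤ n := by exact_mod_cast hn6
    have hn0 : (0 : ℝ) < n := by linarith
    have hL : 3 / 4 ≤ log (√2 + 1) := by
      have h₁ : Real.exp 3 ≤ (√2 + 1) ^ 4 := by
        have h₂ : Real.exp 3 = Real.exp 1 ^ 3 := by rw [← Real.exp_nat_mul]; norm_num
        calc Real.exp 3 ≤ 2.72 ^ 3 := by
              rw [h₂]; gcongr; linarith [Real.exp_one_lt_d9]
          _ ≤ 2.4142 ^ 4 := by norm_num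
          _ ≤ _ := by gcongr; linarith
      rw [← Real.le_log_iff_exp_le (by positivity), Real.log_pow] at h₁
      push_cast at h₁
      linarith
    have hbound : (n + 3) * (26.73 / (n : ℝ) ^ 2) ≤ 3 * (√2 + 1) := by
      rw [← mul_div_assoc, div_le_iff₀ (by positivity)]
      nlinarith
    have hmul : (√2 + 1) * n ≤ (n + 3) * y := by nlinarith
    have hy0 : 0 < y := by
      have : 0 < (n + 3) * y := lt_of_lt_of_le (by positivity) hmul
      exact pos_of_mul_pos_right this (by positivity)
    have hlog := Real.log_le_sub_one_of_pos (show 0 < (√2 + 1) / y by positivity)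
    rw [Real.log_div (by positivity) hy0.ne'] at hlog
    have hratio : n * ((√2 + 1) / y) ≤ n + 3 := by
      rw [← mul_div_assoc, div_le_iff₀ hy0]
      linarith
    nlinarith

/-- The perimeter of the regular right-angled hyperbolic `n₁`-gon plus the perimeter of the
regular right-angled `n₂`-sided polygonal cusp is at least the perimeter of the regular
right-angled `m`-sided polygonal cusp, when `n₁ + n₂ = m + 4`. -/
theorem stmt_16 (n₁ n₂ m : ℕ) (h1 : 5 ≤ n₁) (h2 : 3 ≤ n₂) (h3 : 3 ≤ m)
    (hsum : n₁ + n₂ = m + 4) :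
    2 * (m : ℝ) * Real.log (Real.sqrt 2 + 1) ≤
      2 * (n₁ : ℝ) *
          Real.log (Real.sqrt 2 * Real.cos (π / n₁) + Real.sqrt (Real.cos (2 * π / n₁))) +
        2 * (n₂ : ℝ) * Real.log (Real.sqrt 2 + 1) := by
  have hn := sub_four_mul_log_le h1
  have hm : (n₁ : ℝ) + n₂ = m + 4 := by exact_mod_cast hsum
  have hm' : (m : ℝ) = n₁ + n₂ - 4 := by linarith
  rw [hm']
  linarith
end
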